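/- Let H be a DAT-free digraph. Then H admits a conservative binary polymorphism f and a conservative ternary polymorphism g such that: for every pair of vertices u, v that is not invertible, the restriction of f to {u,v} is a semilattice (commutative and associative); and for every invertible pair u, v, the restriction of g to {u,v} is a majority (g(a,a,b) = g(a,b,a) = g(b,a,a) = a for all a, b ∈ {u,v}). -/

import Mathlib

variable {V : Type*}

/-- A `+` arc of the pair digraph `H⁺`: from `(u,v)` to `(u',v')` when
`uu' ∈ E`, `vv' ∈ E` and `uv' ∉ E`. -/
def PlusArc (E : V → V → Prop) (p q : V × V) : Prop :=
  E p.1 q.1 ∧ E p.2 q.2 ∧ ¬ E p.1 q.2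

/-- A `−` arc of the pair digraph `H⁺`: from `(u,v)` to `(u',v')` when
`u'u ∈ E`, `v'v ∈ E` and `v'u ∉ E`. -/
def MinusArc (E : V → V → Prop) (p q : V × V) : Prop :=
  E q.1 p.1 ∧ E q.2 p.2 ∧ ¬ E q.2 p.1

/-- The arc relation of the pair digraph `H⁺`. -/
def HPlusArc (E : V → V → Prop) (p q : V × V) : Prop :=
  PlusArc E p q ∨ MinusArc E p q

/-- `x 0, x 1, ..., x n` is a walk in the digraph `E` with pattern `ε`:
step `i` is a forward arc if `ε i = true` and a backward arc if `ε i = false`.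
Two walks are congruent iff they have the same length `n` and the same pattern `ε`. -/
def IsWalkOn (E : V → V → Prop) (n : ℕ) (x : ℕ → V) (ε : ℕ → Bool) : Prop :=
  ∀ i < n, if ε i = true then E (x i) (x (i + 1)) else E (x (i + 1)) (x i)

/-- The walk `x` avoids the congruent walk `y` (common pattern `ε`, length `n`):
there is no arc from `x i` to `y (i+1)` in the direction of step `i`. -/
def AvoidsOn (E : V → V → Prop) (n : ℕ) (x y : ℕ → V) (ε : ℕ → Bool) : Prop :=
  ∀ i < n, if ε i = true then ¬ E (x i) (y (i + 1)) else ¬ E (y (i + 1)) (x i)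

/-- `u, v` is an invertible pair: there are congruent walks `P : u → v`, `Q : v → u`
with `P` avoiding `Q`, and congruent walks `P' : v → u`, `Q' : u → v` with `P'`
avoiding `Q'`. -/
def InvertiblePair (E : V → V → Prop) (u v : V) : Prop :=
  (∃ (n : ℕ) (x y : ℕ → V) (ε : ℕ → Bool),
      IsWalkOn E n x ε ∧ IsWalkOn E n y ε ∧
      x 0 = u ∧ x n = v ∧ y 0 = v ∧ y n = u ∧ AvoidsOn E n x y ε) ∧
  (∃ (n : ℕ) (x y : ℕ → V) (ε : ℕ → Bool),
      IsWalkOn E n x ε ∧ IsWalkOn E n y ε ∧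
      x 0 = v ∧ x n = u ∧ y 0 = u ∧ y n = v ∧ AvoidsOn E n x y ε)

/-- The witnessing condition of a permutable triple, for the vertex `x` of the triple
`x, y, z`: there are mutually congruent walks `P : x → sx`, `Q : y → bx`, `R : z → bx`
such that `P` avoids both `Q` and `R`. -/
def TripleWitness (E : V → V → Prop) (x y z sx bx : V) : Prop :=
  ∃ (n : ℕ) (ε : ℕ → Bool) (P Q R : ℕ → V),
    IsWalkOn E n P ε ∧ IsWalkOn E n Q ε ∧ IsWalkOn E n R ε ∧
    P 0 = x ∧ P n = sx ∧ Q 0 = y ∧ Q n = bx ∧ R 0 = z ∧ R n = bx ∧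
    AvoidsOn E n P Q ε ∧ AvoidsOn E n P R ε

/-- `u, v, w` (distinct) form a permutable triple with witnesses
`su, bu, sv, bv, sw, bw`. -/
def PermutableWitnesses (E : V → V → Prop) (u v w su bu sv bv sw bw : V) : Prop :=
  u ≠ v ∧ u ≠ w ∧ v ≠ w ∧
  TripleWitness E u v w su bu ∧ TripleWitness E v u w sv bv ∧ TripleWitness E w u v sw bw

/-- `H` has a permutable triple. -/
def HasPermutableTriple (E : V → V → Prop) : Prop :=
  ∃ u v w su bu sv bv sw bw : V, PermutableWitnesses E u v w su bu sv bv sw bw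

/-- A digraph asteroidal triple (DAT): a permutable triple in which each of the
three pairs `(su,bu)`, `(sv,bv)`, `(sw,bw)` is invertible. -/
def IsDAT (E : V → V → Prop) (u v w su bu sv bv sw bw : V) : Prop :=
  PermutableWitnesses E u v w su bu sv bv sw bw ∧
  InvertiblePair E su bu ∧ InvertiblePair E sv bv ∧ InvertiblePair E sw bw

/-- `H` is DAT-free. -/
def DATFree (E : V → V → Prop) : Prop :=
  ¬ ∃ u v w su bu sv bv sw bw : V, IsDAT E u v w su bu sv bv sw bw

/-- `f` is a binary polymorphism of the digraph `E`. -/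
def BinPoly (E : V → V → Prop) (f : V → V → V) : Prop :=
  ∀ a b a' b', E a a' → E b b' → E (f a b) (f a' b')

/-- A binary operation is conservative. -/
def BinConservative (f : V → V → V) : Prop :=
  ∀ a b, f a b = a ∨ f a b = b

/-- `g` is a ternary polymorphism of the digraph `E`. -/
def TerPoly (E : V → V → Prop) (g : V → V → V → V) : Prop :=
  ∀ a b c a' b' c', E a a' → E b b' → E c c' → E (g a b c) (g a' b' c')

/-- A ternary operation is conservative. -/
def TerConservative (g : V → V → V → V) : Prop :=
  ∀ a b c, g a b c = a ∨ g a b c = b ∨ g a b c = c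

/-- Reachability in the pair digraph. -/
def PReach (E : V → V → Prop) : V × V → V × V → Prop := Relation.ReflTransGen (HPlusArc E)

theorem hplus_skew {E : V → V → Prop} {p q : V × V} (h : HPlusArc E p q) :
    HPlusArc E q.swap p.swap := by
  rcases h with ⟨h1, h2, h3⟩ | ⟨h1, h2, h3⟩
  · exact Or.inr ⟨h2, h1, h3⟩
  · exact Or.inl ⟨h2, h1, h3⟩

theorem preach_skew {E : V → V → Prop} {p q : V × V} (h : PReach E p q) :
    PReach E q.swap p.swap := by
  induction h with
  | refl => exact Relation.ReflTransGen.refl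
  | tail _ h2 ih => exact Relation.ReflTransGen.head (hplus_skew h2) ih

theorem preach_of_walk {E : V → V → Prop} (n : ℕ) (x y : ℕ → V) (ε : ℕ → Bool)
    (hx : IsWalkOn E n x ε) (hy : IsWalkOn E n y ε) (ha : AvoidsOn E n x y ε) :
    PReach E (x 0, y 0) (x n, y n) := by
  induction n with
  | zero => exact Relation.ReflTransGen.refl
  | succ n ih =>
    refine Relation.ReflTransGen.tail
      (ih (fun i hi => hx i (by omega)) (fun i hi => hy i (by omega))
        (fun i hi => ha i (by omega))) ?_
    have h1 := hx n (by omega)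
    have h2 := hy n (by omega)
    have h3 := ha n (by omega)
    by_cases hε : ε n = true
    · simp only [hε, if_true] at h1 h2 h3
      exact Or.inl ⟨h1, h2, h3⟩
    · simp only [hε] at h1 h2 h3
      exact Or.inr ⟨by simpa using h1, by simpa using h2, by simpa using h3⟩

/-- Prepend an element to a sequence. -/
def consSeq {α : Type*} (a : α) (x : ℕ → α) : ℕ → α
  | 0 => a
  | n + 1 => x n

theorem isWalkOn_cons {E : V → V → Prop} {n : ℕ} {x : ℕ → V} {ε : ℕ → Bool} (a : V) (b : Bool)
    (h : if b = true then E a (x 0) else E (x 0) a) (hx : IsWalkOn E n x ε) :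
    IsWalkOn E (n + 1) (consSeq a x) (consSeq b ε) := by
  intro i hi
  cases i with
  | zero => exact h
  | succ i => exact hx i (by omega)

theorem avoidsOn_cons {E : V → V → Prop} {n : ℕ} {x y : ℕ → V} {ε : ℕ → Bool} (a a' : V) (b : Bool)
    (h : if b = true then ¬ E a (y 0) else ¬ E (y 0) a) (hx : AvoidsOn E n x y ε) :
    AvoidsOn E (n + 1) (consSeq a x) (consSeq a' y) (consSeq b ε) := by
  intro i hi
  cases i with
  | zero => exact h
  | succ i => exact hx i (by omega)

theorem walk_of_preach {E : V → V → Prop} {p q : V × V} (h : PReach E p q) :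
    ∃ (n : ℕ) (x y : ℕ → V) (ε : ℕ → Bool),
      IsWalkOn E n x ε ∧ IsWalkOn E n y ε ∧
      x 0 = p.1 ∧ x n = q.1 ∧ y 0 = p.2 ∧ y n = q.2 ∧ AvoidsOn E n x y ε := by
  induction h using Relation.ReflTransGen.head_induction_on with
  | refl =>
    exact ⟨0, fun _ => q.1, fun _ => q.2, fun _ => true, fun i hi => absurd hi (by omega),
      fun i hi => absurd hi (by omega), rfl, rfl, rfl, rfl, fun i hi => absurd hi (by omega)⟩
  | head h1 _ ih =>
    rename_i a c _
    obtain ⟨n, x, y, ε, hx, hy, hx0, hxn, hy0, hyn, hav⟩ := ih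
    rcases h1 with ⟨h1, h2, h3⟩ | ⟨h1, h2, h3⟩
    · exact ⟨n + 1, consSeq a.1 x, consSeq a.2 y, consSeq true ε,
        isWalkOn_cons _ _ (by simpa [hx0] using h1) hx,
        isWalkOn_cons _ _ (by simpa [hy0] using h2) hy, rfl, hxn, rfl, hyn,
        avoidsOn_cons _ _ _ (by simpa [hy0] using h3) hav⟩
    · exact ⟨n + 1, consSeq a.1 x, consSeq a.2 y, consSeq false ε,
        isWalkOn_cons _ _ (by simpa [hx0] using h1) hx,
        isWalkOn_cons _ _ (by simpa [hy0] using h2) hy, rfl, hxn, rfl, hyn,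
        avoidsOn_cons _ _ _ (by simpa [hy0] using h3) hav⟩

/-- Mutual reachability of `p` and its swap in the pair digraph. -/
def PInv (E : V → V → Prop) (p : V × V) : Prop := PReach E p p.swap ∧ PReach E p.swap p

theorem invertible_iff {E : V → V → Prop} {u v : V} :
    InvertiblePair E u v ↔ PInv E (u, v) := by
  constructor
  · rintro ⟨⟨n, x, y, ε, hx, hy, hx0, hxn, hy0, hyn, ha⟩,
      ⟨n', x', y', ε', hx', hy', hx0', hxn', hy0', hyn', ha'⟩⟩
    have h1 := preach_of_walk n x y ε hx hy ha
    have h2 := preach_of_walk n' x' y' ε' hx' hy' ha'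
    rw [hx0, hxn, hy0, hyn] at h1
    rw [hx0', hxn', hy0', hyn'] at h2
    exact ⟨h1, h2⟩
  · rintro ⟨h1, h2⟩
    exact ⟨walk_of_preach h1, walk_of_preach h2⟩

theorem invertible_symm {E : V → V → Prop} {u v : V} (h : InvertiblePair E u v) :
    InvertiblePair E v u := ⟨h.2, h.1⟩

theorem invertible_refl {E : V → V → Prop} (u : V) : InvertiblePair E u u :=
  invertible_iff.2 ⟨Relation.ReflTransGen.refl, Relation.ReflTransGen.refl⟩

/-- Up-closed sets of pairs in which only invertible pairs appear in both orders. -/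
def GoodSet (E : V → V → Prop) (S : Set (V × V)) : Prop :=
  (∀ p q, p ∈ S → HPlusArc E p q → q ∈ S) ∧ (∀ p, p ∈ S → p.swap ∈ S → PInv E p)

theorem GoodSet.reach {E : V → V → Prop} {S : Set (V × V)} (hS : GoodSet E S) {p q : V × V}
    (hp : p ∈ S) (h : PReach E p q) : q ∈ S := by
  induction h with
  | refl => exact hp
  | tail _ h2 ih => exact hS.1 _ _ ih h2

theorem exists_selection (E : V → V → Prop) :
    ∃ S : Set (V × V), GoodSet E S ∧ (∀ p, PInv E p → p ∈ S) ∧ (∀ p, p ∈ S ∨ p.swap ∈ S) := by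
  have hbase : GoodSet E {q | ∃ p, PInv E p ∧ PReach E p q} := by
    constructor
    · rintro p q ⟨r, hr, hrp⟩ hpq
      exact ⟨r, hr, hrp.tail hpq⟩
    · rintro p ⟨r, hr, hrp⟩ ⟨t, ht, htp⟩
      have h1 := preach_skew htp
      have h2 := preach_skew hrp
      rw [Prod.swap_swap] at h1
      exact ⟨h1.trans (ht.2.trans htp), h2.trans (hr.2.trans hrp)⟩
  obtain ⟨M, hM0, hM⟩ := zorn_subset_nonempty {S | GoodSet E S} (by
    intro c hc hchain hne
    refine ⟨⋃₀ c, ⟨?_, ?_⟩, fun s hs => Set.subset_sUnion_of_mem hs⟩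
    · rintro p q ⟨s, hs, hp⟩ hpq
      exact ⟨s, hs, (hc hs).1 p q hp hpq⟩
    · rintro p ⟨s, hs, hp⟩ ⟨t, ht, hp'⟩
      rcases hchain.total hs ht with h | h
      · exact (hc ht).2 p (h hp) hp'
      · exact (hc hs).2 p hp (h hp')) _ hbase
  have hMg : GoodSet E M := hM.prop
  have key : ∀ p, p ∉ M → p.swap ∉ M → PReach E p p.swap := by
    intro p hp hp'
    by_contra hno
    have hgood : GoodSet E (M ∪ {q | PReach E p q}) := by
      constructor
      · rintro a b (ha | ha) hab
        · exact Or.inl (hMg.1 _ _ ha hab)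
        · exact Or.inr (Relation.ReflTransGen.tail ha hab)
      · rintro a (ha | ha) (ha' | ha')
        · exact hMg.2 a ha ha'
        · exfalso
          have h := preach_skew (show PReach E p a.swap from ha')
          rw [Prod.swap_swap] at h
          exact hp' (hMg.reach ha h)
        · exfalso
          exact hp' (hMg.reach ha' (preach_skew ha))
        · exfalso
          have h := preach_skew (show PReach E p a.swap from ha')
          rw [Prod.swap_swap] at h
          exact hno (Relation.ReflTransGen.trans ha h)
    have := hM.le_of_ge (y := M ∪ {q | PReach E p q}) hgood Set.subset_union_left
    exact hp (this (Or.inr Relation.ReflTransGen.refl))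
  have hinv : ∀ p, PInv E p → p ∈ M := fun p hp => hM0 ⟨p, hp, Relation.ReflTransGen.refl⟩
  refine ⟨M, hMg, hinv, fun p => ?_⟩
  by_contra h
  push Not at h
  have h1 := key p h.1 h.2
  have h2 := key p.swap h.2 (by rw [Prod.swap_swap]; exact h.1)
  rw [Prod.swap_swap] at h2
  exact h.1 (hinv p ⟨h1, h2⟩)

theorem exists_binary (E : V → V → Prop) :
    ∃ f : V → V → V, BinPoly E f ∧ BinConservative f ∧
      (∀ u v, ¬ InvertiblePair E u v → f u v = f v u) ∧
      (∀ u v, InvertiblePair E u v → f u v = u) := by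
  classical
  obtain ⟨S, hS, hinv, htot⟩ := exists_selection E
  refine ⟨fun u v => if (u, v) ∈ S then u else v, ?_, ?_, ?_, ?_⟩
  · intro u v u' v' hu hv
    by_cases h1 : (u, v) ∈ S <;> by_cases h2 : (u', v') ∈ S <;> simp only [h1, h2, if_true, if_false]
    · exact hu
    · by_contra h3
      exact h2 (hS.1 _ _ h1 (Or.inl ⟨hu, hv, h3⟩))
    · by_contra h3
      exact h1 (hS.1 _ _ h2 (Or.inr ⟨hu, hv, h3⟩))
    · exact hv
  · intro u v
    by_cases h1 : (u, v) ∈ S <;> simp [h1]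
  · intro u v hn
    rw [invertible_iff] at hn
    by_cases h1 : (u, v) ∈ S
    · have h2 : (v, u) ∉ S := fun h => hn (hS.2 _ h1 h)
      simp [h1, h2]
    · have h2 : (v, u) ∈ S := (htot (u, v)).resolve_left h1
      simp [h1, h2]
  · intro u v h
    have := hinv _ (invertible_iff.1 h)
    simp [this]

/-- The first vertex of the triple cannot be the value of a ternary operation. -/
def BadPos (E : V → V → Prop) (a b c : V) : Prop :=
  ∃ s t, s ≠ t ∧ InvertiblePair E s t ∧ TripleWitness E a b c s t

theorem BadPos.symm {E : V → V → Prop} {a b c : V} (h : BadPos E a b c) : BadPos E a c b := by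
  obtain ⟨s, t, h1, h2, n, ε, P, Q, R, hP, hQ, hR, a1, a2, a3, a4, a5, a6, a7, a8⟩ := h
  exact ⟨s, t, h1, h2, n, ε, P, R, Q, hP, hR, hQ, a1, a2, a5, a6, a3, a4, a8, a7⟩

theorem badPos_zero {E : V → V → Prop} {a b : V} (h : a ≠ b) (hi : InvertiblePair E a b) :
    BadPos E a b b :=
  ⟨a, b, h, hi, 0, fun _ => true, fun _ => a, fun _ => b, fun _ => b,
    fun i hi => absurd hi (by omega), fun i hi => absurd hi (by omega),
    fun i hi => absurd hi (by omega), rfl, rfl, rfl, rfl, rfl, rfl,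
    fun i hi => absurd hi (by omega), fun i hi => absurd hi (by omega)⟩

theorem not_badPos_eq {E : V → V → Prop} {a c : V} : ¬ BadPos E a a c := by
  rintro ⟨s, t, h1, h2, n, ε, P, Q, R, hP, hQ, hR, a1, a2, a3, a4, a5, a6, a7, a8⟩
  cases n with
  | zero => exact h1 (by rw [← a2, ← a4, a1, a3])
  | succ n =>
    have e1 := hQ 0 (by omega)
    have e2 := a7 0 (by omega)
    rw [a3] at e1
    rw [a1] at e2
    by_cases hε : ε 0 = true
    · simp only [hε, if_true] at e1 e2
      exact e2 e1
    · rw [if_neg hε] at e1 e2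
      exact e2 e1

theorem BadPos.cons_fwd {E : V → V → Prop} {a b c a' b' c' : V} (h : BadPos E a' b' c')
    (ha : E a a') (hb : E b b') (hc : E c c') (hab : ¬ E a b') (hac : ¬ E a c') :
    BadPos E a b c := by
  obtain ⟨s, t, h1, h2, n, ε, P, Q, R, hP, hQ, hR, a1, a2, a3, a4, a5, a6, a7, a8⟩ := h
  exact ⟨s, t, h1, h2, n + 1, consSeq true ε, consSeq a P, consSeq b Q, consSeq c R,
    isWalkOn_cons _ _ (by simpa [a1] using ha) hP, isWalkOn_cons _ _ (by simpa [a3] using hb) hQ,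
    isWalkOn_cons _ _ (by simpa [a5] using hc) hR, rfl, a2, rfl, a4, rfl, a6,
    avoidsOn_cons _ _ _ (by simpa [a3] using hab) a7,
    avoidsOn_cons _ _ _ (by simpa [a5] using hac) a8⟩

theorem BadPos.cons_bwd {E : V → V → Prop} {a b c a' b' c' : V} (h : BadPos E a' b' c')
    (ha : E a' a) (hb : E b' b) (hc : E c' c) (hab : ¬ E b' a) (hac : ¬ E c' a) :
    BadPos E a b c := by
  obtain ⟨s, t, h1, h2, n, ε, P, Q, R, hP, hQ, hR, a1, a2, a3, a4, a5, a6, a7, a8⟩ := h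
  exact ⟨s, t, h1, h2, n + 1, consSeq false ε, consSeq a P, consSeq b Q, consSeq c R,
    isWalkOn_cons _ _ (by simpa [a1] using ha) hP, isWalkOn_cons _ _ (by simpa [a3] using hb) hQ,
    isWalkOn_cons _ _ (by simpa [a5] using hc) hR, rfl, a2, rfl, a4, rfl, a6,
    avoidsOn_cons _ _ _ (by simpa [a3] using hab) a7,
    avoidsOn_cons _ _ _ (by simpa [a5] using hac) a8⟩

/-- If allowed choices `a` and `b'` conflict, both positions are allowed at both ends. -/
theorem conflict_both {E : V → V → Prop} {a b c a' b' c' : V}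
    (ha : E a a') (hb : E b b') (hc : E c c')
    (hi : InvertiblePair E a b) (hi' : InvertiblePair E a' b')
    (h1 : ¬ BadPos E a b c) (h2 : ¬ BadPos E b' a' c') (hn : ¬ E a b') :
    ¬ BadPos E a' b' c' ∧ ¬ BadPos E b a c := by
  have hab : b ≠ a := by rintro rfl; exact hn hb
  have hab' : a' ≠ b' := by rintro rfl; exact hn ha
  have hac : ¬ E a c' := fun h =>
    h2 (BadPos.cons_bwd (badPos_zero hab (invertible_symm hi)) hb ha h hn hn)
  have hcb : ¬ E c b' := fun h =>
    h1 (BadPos.cons_fwd (badPos_zero hab' hi') ha hb h hn hn)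
  exact ⟨fun h => h1 (h.cons_fwd ha hb hc hn hac), fun h => h2 (h.cons_bwd hb ha hc hn hcb)⟩

open Classical in
/-- The first allowed vertex of the triple. -/
noncomputable def firstAllowed (E : V → V → Prop) (a b c : V) : V :=
  if ¬ BadPos E a b c then a else if ¬ BadPos E b a c then b else c

/-- All pairs of the triple are invertible (or trivial). -/
def PairwiseInv (E : V → V → Prop) (a b c : V) : Prop :=
  InvertiblePair E a b ∧ InvertiblePair E a c ∧ InvertiblePair E b c

theorem exists_allowed {E : V → V → Prop} (hfree : DATFree E) (a b c : V) :
    ¬ BadPos E a b c ∨ ¬ BadPos E b a c ∨ ¬ BadPos E c a b := by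
  by_contra h
  push Not at h
  obtain ⟨h1, h2, h3⟩ := h
  have hab : a ≠ b := by rintro rfl; exact not_badPos_eq h1
  have hac : a ≠ c := by rintro rfl; exact not_badPos_eq h1.symm
  have hbc : b ≠ c := by rintro rfl; exact not_badPos_eq h2.symm
  obtain ⟨s1, t1, -, i1, w1⟩ := h1
  obtain ⟨s2, t2, -, i2, w2⟩ := h2
  obtain ⟨s3, t3, -, i3, w3⟩ := h3
  exact hfree ⟨a, b, c, s1, t1, s2, t2, s3, t3, ⟨hab, hac, hbc, w1, w2, w3⟩, i1, i2, i3⟩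

theorem firstAllowed_spec {E : V → V → Prop} (hfree : DATFree E) (a b c : V) :
    (firstAllowed E a b c = a ∧ ¬ BadPos E a b c) ∨
    (firstAllowed E a b c = b ∧ BadPos E a b c ∧ ¬ BadPos E b a c) ∨
    (firstAllowed E a b c = c ∧ BadPos E a b c ∧ BadPos E b a c ∧ ¬ BadPos E c a b) := by
  unfold firstAllowed
  have := exists_allowed hfree a b c
  by_cases h1 : BadPos E a b c <;> by_cases h2 : BadPos E b a c <;> simp_all

theorem firstAllowed_poly {E : V → V → Prop} (hfree : DATFree E) {a b c a' b' c' : V}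
    (ha : E a a') (hb : E b b') (hc : E c c')
    (hi : PairwiseInv E a b c) (hi' : PairwiseInv E a' b' c') :
    E (firstAllowed E a b c) (firstAllowed E a' b' c') := by
  obtain ⟨i1, i2, i3⟩ := hi
  obtain ⟨j1, j2, j3⟩ := hi'
  have sy : ∀ {x y z : V}, ¬ BadPos E x y z → ¬ BadPos E x z y := fun h h' => h h'.symm
  rcases firstAllowed_spec hfree a b c with ⟨e, h1⟩ | ⟨e, h1, h2⟩ | ⟨e, h1, h2, h3⟩ <;>
  rcases firstAllowed_spec hfree a' b' c' with ⟨e', k1⟩ | ⟨e', k1, k2⟩ | ⟨e', k1, k2, k3⟩ <;>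
  rw [e, e'] <;> first | assumption | skip
  all_goals by_contra hn
  · exact (conflict_both ha hb hc i1 j1 h1 k2 hn).1 k1
  · exact (conflict_both ha hc hb i2 j2 (sy h1) k3 hn).1 k1.symm
  · exact (conflict_both hb ha hc (invertible_symm i1) (invertible_symm j1) h2 k1 hn).2 h1
  · exact (conflict_both hb hc ha i3 j3 (sy h2) (sy k3) hn).1 k2.symm
  · exact (conflict_both hc ha hb (invertible_symm i2) (invertible_symm j2) h3 (sy k1) hn).2 h1.symm
  · exact (conflict_both hc hb ha (invertible_symm i3) (invertible_symm j3) (sy h3) (sy k2) hn).2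
      h2.symm

theorem firstAllowed_maj {E : V → V → Prop} {a b : V} (hi : InvertiblePair E a b) :
    firstAllowed E a a b = a ∧ firstAllowed E a b a = a ∧ firstAllowed E b a a = a := by
  have n1 : ¬ BadPos E a a b := not_badPos_eq
  have n2 : ¬ BadPos E a b a := fun h => n1 h.symm
  refine ⟨by simp [firstAllowed, n1], by simp [firstAllowed, n2], ?_⟩
  by_cases hab : b = a
  · subst hab; simp [firstAllowed]
  · have h := badPos_zero hab (invertible_symm hi)
    simp [firstAllowed, h, n2]

theorem firstAllowed_cons (E : V → V → Prop) (a b c : V) :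
    firstAllowed E a b c = a ∨ firstAllowed E a b c = b ∨ firstAllowed E a b c = c := by
  unfold firstAllowed
  split_ifs <;> simp

/-- After the first reduction step the triple is good, or trivially reducible. -/
theorem reduce_pairwise {I : V → V → Prop} {f : V → V → V}
    (hr : ∀ u, I u u) (hs : ∀ u v, I u v → I v u)
    (hc : ∀ u v, f u v = u ∨ f u v = v)
    (hn : ∀ u v, ¬ I u v → f u v = f v u) (hp : ∀ u v, I u v → f u v = u) (a b c : V) :
    ∃ x y z, x = f (f a b) c ∧ y = f (f b c) a ∧ z = f (f c a) b ∧
      I (f (f x y) z) (f (f y x) z) ∧ I (f (f x y) z) (f z (f (f x y) z)) ∧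
      I (f (f y x) z) (f z (f (f x y) z)) := by
  refine ⟨_, _, _, rfl, rfl, rfl, ?_⟩
  have cl : ∀ u v, (I u v ∧ I v u ∧ f u v = u ∧ f v u = v) ∨
      (¬ I u v ∧ f u v = u ∧ f v u = u) ∨ (¬ I u v ∧ f u v = v ∧ f v u = v) := by
    intro u v
    by_cases h : I u v
    · exact Or.inl ⟨h, hs _ _ h, hp _ _ h, hp _ _ (hs _ _ h)⟩
    · have := hn u v h
      rcases hc u v with h' | h'
      · exact Or.inr (Or.inl ⟨h, h', by rw [← this, h']⟩)
      · exact Or.inr (Or.inr ⟨h, h', by rw [← this, h']⟩)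
  have id : ∀ u, f u u = u := fun u => hp u u (hr u)
  rcases cl a b with ⟨h1, h2, h3, h4⟩ | ⟨h1, h3, h4⟩ | ⟨h1, h3, h4⟩ <;>
  rcases cl b c with ⟨k1, k2, k3, k4⟩ | ⟨k1, k3, k4⟩ | ⟨k1, k3, k4⟩ <;>
  rcases cl a c with ⟨l1, l2, l3, l4⟩ | ⟨l1, l3, l4⟩ | ⟨l1, l3, l4⟩ <;>
  simp [*]

/-- A DAT-free digraph admits a conservative binary polymorphism `f` and a conservative
ternary polymorphism `g` such that: on every non-invertible pair the restriction of `f`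
is a semilattice, and on every invertible pair the restriction of `g` is a majority. -/
theorem datfree_two_polymorphisms (E : V → V → Prop) (hfree : DATFree E) :
    ∃ (f : V → V → V) (g : V → V → V → V),
      BinPoly E f ∧ BinConservative f ∧ TerPoly E g ∧ TerConservative g ∧
      (∀ u v : V, ¬ InvertiblePair E u v →
        ∀ a ∈ ({u, v} : Set V), ∀ b ∈ ({u, v} : Set V), ∀ c ∈ ({u, v} : Set V),
          f a b ∈ ({u, v} : Set V) ∧ f a b = f b a ∧ f a (f b c) = f (f a b) c) ∧
      (∀ u v : V, InvertiblePair E u v →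
        ∀ a ∈ ({u, v} : Set V), ∀ b ∈ ({u, v} : Set V),
          g a a b = a ∧ g a b a = a ∧ g b a a = a) := by
  obtain ⟨f, hfp, hfc, hfn, hfi⟩ := exists_binary E
  have hred := reduce_pairwise (I := InvertiblePair E) (f := f) invertible_refl
    (fun _ _ h => invertible_symm h) hfc hfn hfi
  have hidem : ∀ u, f u u = u := fun u => hfi u u (invertible_refl u)
  let X : V → V → V → V := fun a b c => f (f a b) c
  let m : V → V → V → V := fun x y z =>
    firstAllowed E (f (f x y) z) (f (f y x) z) (f z (f (f x y) z))
  refine ⟨f, fun a b c => m (X a b c) (X b c a) (X c a b), hfp, hfc, ?_, ?_, ?_, ?_⟩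
  · intro a b c a' b' c' ha hb hc
    have hX : ∀ {a b c a' b' c'}, E a a' → E b b' → E c c' → E (X a b c) (X a' b' c') :=
      fun h1 h2 h3 => hfp _ _ _ _ (hfp _ _ _ _ h1 h2) h3
    have e1 := hX ha hb hc
    have e2 := hX hb hc ha
    have e3 := hX hc ha hb
    obtain ⟨x, y, z, rfl, rfl, rfl, r⟩ := hred a b c
    obtain ⟨x', y', z', rfl, rfl, rfl, r'⟩ := hred a' b' c'
    exact firstAllowed_poly hfree (hX e1 e2 e3) (hX e2 e1 e3) (hfp _ _ _ _ e3 (hX e1 e2 e3)) r r'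
  · intro a b c
    have hX : ∀ a b c, X a b c = a ∨ X a b c = b ∨ X a b c = c := by
      intro a b c
      have h1 := hfc a b
      have h2 := hfc (f a b) c
      simp only [X]
      rcases h1 with h1 | h1 <;> rcases h2 with h2 | h2 <;> rw [h1] at h2 ⊢ <;> simp [h2]
    have hm : ∀ a b c, m a b c = a ∨ m a b c = b ∨ m a b c = c := by
      intro a b c
      have h1 := hX a b c
      have h2 := hX b a c
      have h3 := hfc c (X a b c)
      have h4 := firstAllowed_cons E (X a b c) (X b a c) (f c (X a b c))
      change m a b c = _ ∨ m a b c = _ ∨ m a b c = _ at h4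
      grind
    have h1 := hX a b c
    have h2 := hX b c a
    have h3 := hX c a b
    have h4 := hm (X a b c) (X b c a) (X c a b)
    grind
  · intro u v hn a ha b hb c hc
    have hcomm := hfn u v hn
    simp only [Set.mem_insert_iff, Set.mem_singleton_iff] at ha hb hc ⊢
    have hu := hidem u
    have hv := hidem v
    rcases hfc u v with h | h <;> rw [h] at hcomm <;> have hcomm' := hcomm.symm <;>
      clear hcomm <;> rcases ha with rfl | rfl <;> rcases hb with rfl | rfl <;>
      rcases hc with rfl | rfl <;> simp [*]
  · intro u v hi a ha b hb
    have hab : InvertiblePair E a b := by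
      simp only [Set.mem_insert_iff, Set.mem_singleton_iff] at ha hb
      rcases ha with rfl | rfl <;> rcases hb with rfl | rfl
      · exact invertible_refl _
      · exact hi
      · exact invertible_symm hi
      · exact invertible_refl _
    have h1 := hfi a b hab
    have h2 := hfi b a (invertible_symm hab)
    simp only [m, X, h1, h2, hidem]
    exact firstAllowed_maj hab
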